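/- (Theorem 2) A formula β ∈ L_4PrŁΔ is 4PrŁΔ valid if and only if the formula β^± ∈ L_PrŁ²Δ is Pr_Ł²Δ valid, where the translation (·)^± is defined by (Bl φ)^± = Pr φ ⊖ Pr(φ∧¬φ); (Cf φ)^± = Pr(φ∧¬φ); (Uc φ)^± = ∼Pr(φ∨¬φ); (Db φ)^± = Pr ¬φ ⊖ Pr(φ∧¬φ); (∼β)^± = ∼β^±; (Δβ)^± = Δβ^±; (β→β')^± = β^± → β'^±. -/

import Mathlib

inductive BD : Type where
  | var : ℕ → BD
  | neg : BD → BD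
  | and : BD → BD → BD
  | or  : BD → BD → BD

structure BDModel (W : Type) where
  vpos : ℕ → Set W
  vneg : ℕ → Set W

mutual
  def suppT {W : Type} (M : BDModel W) : BD → W → Prop
    | .var p, w => w ∈ M.vpos p
    | .neg φ, w => suppF M φ w
    | .and φ χ, w => suppT M φ w ∧ suppT M χ w
    | .or φ χ, w => suppT M φ w ∨ suppT M χ w
  def suppF {W : Type} (M : BDModel W) : BD → W → Prop
    | .var p, w => w ∈ M.vneg p
    | .neg φ, w => suppT M φ w
    | .and φ χ, w => suppF M φ w ∨ suppF M χ w
    | .or φ χ, w => suppF M φ w ∧ suppF M χ w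
end

def extP {W : Type} (M : BDModel W) (φ : BD) : Set W := {w | suppT M φ w}
def extN {W : Type} (M : BDModel W) (φ : BD) : Set W := {w | suppF M φ w}

/-- A BD model (on a nonempty carrier) together with a ±-probability. -/
structure PrModel (W : Type) [Nonempty W] where
  M : BDModel W
  mu : Set W → ℝ
  mu_mem : ∀ X : Set W, mu X ∈ Set.Icc (0:ℝ) 1
  mon : ∀ X Y : Set W, X ⊆ Y → mu X ≤ mu Y
  negp : ∀ φ : BD, mu (extN M φ) = mu (extP M (.neg φ))
  ex : ∀ φ χ : BD,
    mu (extP M (.or φ χ)) = mu (extP M φ) + mu (extP M χ) - mu (extP M (.and φ χ))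

/-- The language L_PrŁ²Δ: α ::= Pr φ | ¬α | ∼α | Δα | (α→α). -/
inductive PrF : Type where
  | pr : BD → PrF
  | neg : PrF → PrF
  | snot : PrF → PrF
  | delta : PrF → PrF
  | imp : PrF → PrF → PrF

open Classical in
mutual
  /-- Support of truth e₁ in a Pr_Ł²Δ model. -/
  noncomputable def pe1 {W : Type} [Nonempty W] (P : PrModel W) : PrF → ℝ
    | .pr φ => P.mu (extP P.M φ)
    | .neg α => pe2 P α
    | .snot α => 1 - pe1 P α
    | .delta α => if pe1 P α = 1 then 1 else 0
    | .imp α β => min 1 (1 - pe1 P α + pe1 P β)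
  /-- Support of falsity e₂ in a Pr_Ł²Δ model. -/
  noncomputable def pe2 {W : Type} [Nonempty W] (P : PrModel W) : PrF → ℝ
    | .pr φ => P.mu (extN P.M φ)
    | .neg α => pe1 P α
    | .snot α => 1 - pe2 P α
    | .delta α => if pe2 P α = 0 then 0 else 1
    | .imp α β => max 0 (pe2 P β - pe2 P α)
end

/-- Pr_Ł²Δ validity: value (1,0) in every model. -/
def PrValid (α : PrF) : Prop :=
  ∀ (W : Type) (_ : Nonempty W) (P : PrModel W), pe1 P α = 1 ∧ pe2 P α = 0

/-- The ¬-normal form transformation pushing ¬ to modal atoms. -/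
def PrF.nnf : PrF → PrF
  | .pr φ => .pr φ
  | .snot α => .snot α.nnf
  | .delta α => .delta α.nnf
  | .imp α β => .imp α.nnf β.nnf
  | .neg (.pr φ) => .pr (.neg φ)
  | .neg (.neg α) => α.nnf
  | .neg (.snot α) => .snot (PrF.nnf (.neg α))
  | .neg (.imp α β) => .snot (.imp (PrF.nnf (.neg β)) (PrF.nnf (.neg α)))
  | .neg (.delta α) => .snot (.delta (.snot (PrF.nnf (.neg α))))

/-- Pure belief extension |φ|^b = |φ|⁺ ∖ |φ|⁻. -/
def extB {W : Type} (M : BDModel W) (φ : BD) : Set W := extP M φ \ extN M φ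
/-- Pure disbelief extension |φ|^d = |φ|⁻ ∖ |φ|⁺. -/
def extD {W : Type} (M : BDModel W) (φ : BD) : Set W := extN M φ \ extP M φ
/-- Conflict extension |φ|^c = |φ|⁺ ∩ |φ|⁻. -/
def extC {W : Type} (M : BDModel W) (φ : BD) : Set W := extP M φ ∩ extN M φ
/-- Uncertainty extension |φ|^u = W ∖ (|φ|⁺ ∪ |φ|⁻). -/
def extU {W : Type} (M : BDModel W) (φ : BD) : Set W := (extP M φ ∪ extN M φ)ᶜ

/-- A BD model (on a nonempty carrier) with a 4-probability. -/
structure FourModel (W : Type) [Nonempty W] where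
  M : BDModel W
  mu : Set W → ℝ
  mu_mem : ∀ X : Set W, mu X ∈ Set.Icc (0:ℝ) 1
  part : ∀ φ : BD, mu (extB M φ) + mu (extD M φ) + mu (extU M φ) + mu (extC M φ) = 1
  negb : ∀ φ : BD, mu (extB M (.neg φ)) = mu (extD M φ)
  negc : ∀ φ : BD, mu (extC M (.neg φ)) = mu (extC M φ)
  contrb : ∀ φ : BD, mu (extB M (.and φ (.neg φ))) = 0
  contrc : ∀ φ : BD, mu (extC M (.and φ (.neg φ))) = mu (extC M φ)
  bcmon : ∀ φ ψ : BD, extP M φ ⊆ extP M ψ → extN M ψ ⊆ extN M φ →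
    mu (extB M φ) + mu (extC M φ) ≤ mu (extB M ψ) + mu (extC M ψ)
  bcex : ∀ φ ψ : BD,
    mu (extB M φ) + mu (extC M φ) + mu (extB M ψ) + mu (extC M ψ) =
      mu (extB M (.and φ ψ)) + mu (extC M (.and φ ψ)) +
        mu (extB M (.or φ ψ)) + mu (extC M (.or φ ψ))

/-- The language L_4PrŁΔ: α ::= Bl φ | Db φ | Cf φ | Uc φ | ∼α | Δα | (α→α). -/
inductive FourF : Type where
  | bl : BD → FourF
  | db : BD → FourF
  | cf : BD → FourF
  | uc : BD → FourF
  | snot : FourF → FourF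
  | delta : FourF → FourF
  | imp : FourF → FourF → FourF

open Classical in
/-- Evaluation of L_4PrŁΔ formulas in a 4PrŁΔ model (standard Ł_Δ operations). -/
noncomputable def fe {W : Type} [Nonempty W] (F : FourModel W) : FourF → ℝ
  | .bl φ => F.mu (extB F.M φ)
  | .db φ => F.mu (extD F.M φ)
  | .cf φ => F.mu (extC F.M φ)
  | .uc φ => F.mu (extU F.M φ)
  | .snot α => 1 - fe F α
  | .delta α => if fe F α = 1 then 1 else 0
  | .imp α β => min 1 (1 - fe F α + fe F β)

/-- 4PrŁΔ validity: value 1 in every model. -/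
def FourValid (α : FourF) : Prop :=
  ∀ (W : Type) (_ : Nonempty W) (F : FourModel W), fe F α = 1

/-- α⊕β := ∼α→β in L_4PrŁΔ. -/
def FourF.oplus (α β : FourF) : FourF := .imp (.snot α) β
/-- α⊙β := ∼(α→∼β) in L_4PrŁΔ. -/
def FourF.odot (α β : FourF) : FourF := .snot (.imp α (.snot β))
/-- α⊖β := α⊙∼β in L_4PrŁΔ. -/
def FourF.ominus (α β : FourF) : FourF := α.odot (.snot β)
/-- α↔β := (α→β)⊙(β→α) in L_4PrŁΔ. -/
def FourF.biimp (α β : FourF) : FourF := FourF.odot (.imp α β) (.imp β α)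

/-- α⊙β := ∼(α→∼β) in L_PrŁ²Δ. -/
def PrF.odot (α β : PrF) : PrF := .snot (.imp α (.snot β))
/-- α⊖β := α⊙∼β in L_PrŁ²Δ. -/
def PrF.ominus (α β : PrF) : PrF := α.odot (.snot β)

/-- The translation (·)^± of L_4PrŁΔ into L_PrŁ²Δ:
(Bl φ)^± = Pr φ ⊖ Pr(φ∧¬φ); (Cf φ)^± = Pr(φ∧¬φ); (Uc φ)^± = ∼Pr(φ∨¬φ);
(Db φ)^± = Pr ¬φ ⊖ Pr(φ∧¬φ); commuting with ∼, Δ and →. -/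
def FourF.toPr : FourF → PrF
  | .bl φ => PrF.ominus (.pr φ) (.pr (.and φ (.neg φ)))
  | .cf φ => .pr (.and φ (.neg φ))
  | .uc φ => .snot (.pr (.or φ (.neg φ)))
  | .db φ => PrF.ominus (.pr (.neg φ)) (.pr (.and φ (.neg φ)))
  | .snot β => .snot β.toPr
  | .delta β => .delta β.toPr
  | .imp β γ => .imp β.toPr γ.toPr

/-! ### Evaluation of `FourF` formulas via the translation -/

theorem pe1_ominus {W : Type} [Nonempty W] (P : PrModel W) (α β : PrF) :
    pe1 P (α.ominus β) = 1 - min 1 (1 - pe1 P α + pe1 P β) := by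
  simp only [PrF.ominus, PrF.odot, pe1]
  ring_nf

theorem fe_eq_pe1_toPr {W W' : Type} [Nonempty W] [Nonempty W'] (F : FourModel W)
    (P : PrModel W')
    (hpos : ∀ φ, P.mu (extP P.M φ) = F.mu (extB F.M φ) + F.mu (extC F.M φ)) (β : FourF) :
    pe1 P β.toPr = fe F β := by
  have hneg (φ : BD) :
      P.mu (extP P.M φ.neg) = F.mu (extD F.M φ) + F.mu (extC F.M φ) := by
    rw [hpos, F.negb, F.negc]
  have hcf (φ : BD) : P.mu (extP P.M (φ.and φ.neg)) = F.mu (extC F.M φ) := by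
    rw [hpos, F.contrb, F.contrc, zero_add]
  induction β with
  | bl φ =>
    have := (F.mu_mem (extB F.M φ)).1
    simp only [FourF.toPr, pe1_ominus, pe1, fe, hpos φ, hcf]
    rw [min_eq_right (by linarith)]
    ring
  | db φ =>
    have := (F.mu_mem (extD F.M φ)).1
    simp only [FourF.toPr, pe1_ominus, pe1, fe, hneg, hcf]
    rw [min_eq_right (by linarith)]
    ring
  | cf φ => simp only [FourF.toPr, pe1, fe, hcf]
  | uc φ =>
    simp only [FourF.toPr, pe1, fe]
    linarith [P.ex φ φ.neg, hpos φ, hneg φ, hcf φ, F.part φ]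
  | snot α ih => simp only [FourF.toPr, pe1, fe, ih]
  | delta α ih => simp only [FourF.toPr, pe1, fe, ih]
  | imp α γ ihα ihγ => simp only [FourF.toPr, pe1, fe, ihα, ihγ]

/-! ### Dual models -/

/-- The dual of a BD model: `p` is true iff it was not false, and false iff it was not true. -/
def BDModel.dual {W : Type} (M : BDModel W) : BDModel W where
  vpos p := (M.vneg p)ᶜ
  vneg p := (M.vpos p)ᶜ

theorem BDModel.supp_dual {W : Type} (M : BDModel W) (φ : BD) (w : W) :
    (suppT M.dual φ w ↔ ¬ suppF M φ w) ∧ (suppF M.dual φ w ↔ ¬ suppT M φ w) := by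
  induction φ with
  | var p => simp [suppT, suppF, BDModel.dual]
  | neg φ ih => simpa [suppT, suppF] using ih.symm
  | and φ χ ihφ ihχ => simp only [suppT, suppF, ihφ, ihχ]; tauto
  | or φ χ ihφ ihχ => simp only [suppT, suppF, ihφ, ihχ]; tauto

theorem BDModel.extP_dual {W : Type} (M : BDModel W) (φ : BD) :
    extP M.dual φ = (extN M φ)ᶜ :=
  Set.ext fun w => (M.supp_dual φ w).1

theorem BDModel.extN_dual {W : Type} (M : BDModel W) (φ : BD) :
    extN M.dual φ = (extP M φ)ᶜ :=
  Set.ext fun w => (M.supp_dual φ w).2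

theorem extN_eq_extP_neg {W : Type} (M : BDModel W) (φ : BD) :
    extN M φ = extP M φ.neg := by
  simp [extN, extP, suppT]

theorem extP_and {W : Type} (M : BDModel W) (φ χ : BD) :
    extP M (φ.and χ) = extP M φ ∩ extP M χ := by
  ext; simp [extP, suppT]

theorem extP_or {W : Type} (M : BDModel W) (φ χ : BD) :
    extP M (φ.or χ) = extP M φ ∪ extP M χ := by
  ext; simp [extP, suppT]

theorem extN_and {W : Type} (M : BDModel W) (φ χ : BD) :
    extN M (φ.and χ) = extN M φ ∪ extN M χ := by
  ext; simp [extN, suppF]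

theorem extN_or {W : Type} (M : BDModel W) (φ χ : BD) :
    extN M (φ.or χ) = extN M φ ∩ extN M χ := by
  ext; simp [extN, suppF]

theorem extN_neg {W : Type} (M : BDModel W) (φ : BD) : extN M φ.neg = extP M φ := by
  simp [extN, extP, suppF]

/-- The dual of a ±-probability model, with measure `X ↦ 1 - μ Xᶜ`. -/
def PrModel.dual {W : Type} [Nonempty W] (P : PrModel W) : PrModel W where
  M := P.M.dual
  mu X := 1 - P.mu Xᶜ
  mu_mem X := by
    have := P.mu_mem Xᶜ
    exact ⟨by linarith [this.2], by linarith [this.1]⟩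
  mon X Y h := by linarith [P.mon _ _ (Set.compl_subset_compl.mpr h)]
  negp φ := by rw [extN_eq_extP_neg]
  ex φ χ := by
    simp only [BDModel.extP_dual, compl_compl]
    have := P.ex φ.neg χ.neg
    simp only [extP_or, extP_and, ← extN_eq_extP_neg] at this
    rw [extN_or, extN_and]
    linarith

theorem PrModel.pe_dual {W : Type} [Nonempty W] (P : PrModel W) (α : PrF) :
    pe1 P.dual α = 1 - pe2 P α ∧ pe2 P.dual α = 1 - pe1 P α := by
  induction α with
  | pr φ => simp [pe1, pe2, PrModel.dual, BDModel.extP_dual, BDModel.extN_dual]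
  | neg α ih => simpa only [pe1, pe2] using ih.symm
  | snot α ih => simp only [pe1, pe2, ih, and_self]
  | delta α ih =>
    simp only [pe1, pe2, ih, sub_eq_self, sub_eq_zero, eq_comm (a := (1 : ℝ))]
    constructor <;> split_ifs <;> simp
  | imp α β ihα ihβ =>
    simp only [pe1, pe2, ihα, ihβ]
    constructor
    · rcases le_total 0 (pe2 P β - pe2 P α) with h | h
      · rw [max_eq_right h, min_eq_right (by linarith)]; ring
      · rw [max_eq_left h, min_eq_left (by linarith)]; ring
    · rcases le_total 1 (1 - pe1 P α + pe1 P β) with h | h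
      · rw [min_eq_left h, max_eq_left (by linarith)]; ring
      · rw [min_eq_right h, max_eq_right (by linarith)]; ring

/-! ### From 4-probabilities to ±-probabilities -/

/-- The disjoint union of a BD model with its dual. -/
def BDModel.sumDual {W : Type} (M : BDModel W) : BDModel (W ⊕ W) where
  vpos p := Sum.elim (M.vpos p) (M.dual.vpos p)
  vneg p := Sum.elim (M.vneg p) (M.dual.vneg p)

theorem BDModel.supp_sumDual_inl {W : Type} (M : BDModel W) (φ : BD) (w : W) :
    (suppT M.sumDual φ (.inl w) ↔ suppT M φ w) ∧
      (suppF M.sumDual φ (.inl w) ↔ suppF M φ w) := by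
  induction φ with
  | var p => exact ⟨Iff.rfl, Iff.rfl⟩
  | neg φ ih => simpa [suppT, suppF] using ih.symm
  | and φ χ ihφ ihχ => simp only [suppT, suppF, ihφ, ihχ, and_self]
  | or φ χ ihφ ihχ => simp only [suppT, suppF, ihφ, ihχ, and_self]

theorem BDModel.supp_sumDual_inr {W : Type} (M : BDModel W) (φ : BD) (w : W) :
    (suppT M.sumDual φ (.inr w) ↔ suppT M.dual φ w) ∧
      (suppF M.sumDual φ (.inr w) ↔ suppF M.dual φ w) := by
  induction φ with
  | var p => exact ⟨Iff.rfl, Iff.rfl⟩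
  | neg φ ih => simpa [suppT, suppF] using ih.symm
  | and φ χ ihφ ihχ => simp only [suppT, suppF, ihφ, ihχ, and_self]
  | or φ χ ihφ ihχ => simp only [suppT, suppF, ihφ, ihχ, and_self]

theorem BDModel.ext_subset_of_extP_sumDual_subset {W : Type} (M : BDModel W) {φ ψ : BD}
    (h : extP M.sumDual φ ⊆ extP M.sumDual ψ) :
    extP M φ ⊆ extP M ψ ∧ extN M ψ ⊆ extN M φ := by
  constructor
  · intro w hw
    exact (M.supp_sumDual_inl ψ w).1.1 (h ((M.supp_sumDual_inl φ w).1.2 hw))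
  · rw [← Set.compl_subset_compl, ← M.extP_dual, ← M.extP_dual]
    intro w hw
    exact (M.supp_sumDual_inr ψ w).1.1 (h ((M.supp_sumDual_inr φ w).1.2 hw))

/-- The belief in `φ` (pure belief plus conflict) of a 4-probability. -/
def FourModel.bel {W : Type} [Nonempty W] (F : FourModel W) (φ : BD) : ℝ :=
  F.mu (extB F.M φ) + F.mu (extC F.M φ)

theorem FourModel.bel_nonneg {W : Type} [Nonempty W] (F : FourModel W) (φ : BD) :
    0 ≤ F.bel φ :=
  add_nonneg (F.mu_mem _).1 (F.mu_mem _).1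

theorem FourModel.bel_le_one {W : Type} [Nonempty W] (F : FourModel W) (φ : BD) :
    F.bel φ ≤ 1 := by
  unfold FourModel.bel
  linarith [F.part φ, (F.mu_mem (extD F.M φ)).1, (F.mu_mem (extU F.M φ)).1]

/-- The values of the belief function on the formulas whose positive extension in the sum with
the dual lies in `X`, together with `0`. -/
def FourModel.innerValues {W : Type} [Nonempty W] (F : FourModel W) (X : Set (W ⊕ W)) : Set ℝ :=
  insert 0 (F.bel '' {φ | extP F.M.sumDual φ ⊆ X})

theorem FourModel.innerValues_le_one {W : Type} [Nonempty W] (F : FourModel W)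
    (X : Set (W ⊕ W)) : ∀ r ∈ F.innerValues X, r ≤ 1 := by
  rintro r (rfl | ⟨φ, -, rfl⟩)
  · exact zero_le_one
  · exact F.bel_le_one φ

theorem FourModel.sSup_innerValues_extP {W : Type} [Nonempty W] (F : FourModel W) (φ : BD) :
    sSup (F.innerValues (extP F.M.sumDual φ)) = F.bel φ := by
  refine IsGreatest.csSup_eq ⟨Or.inr ⟨φ, Set.Subset.rfl, rfl⟩, ?_⟩
  rintro r (rfl | ⟨ψ, h, rfl⟩)
  · exact F.bel_nonneg φ
  · obtain ⟨hpos, hneg⟩ := F.M.ext_subset_of_extP_sumDual_subset h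
    exact F.bcmon ψ φ hpos hneg

/-- The ±-probability model induced by a 4-probability model. -/
noncomputable def FourModel.toPrModel {W : Type} [Nonempty W] (F : FourModel W) :
    PrModel (W ⊕ W) where
  M := F.M.sumDual
  mu X := sSup (F.innerValues X)
  mu_mem X :=
    ⟨le_csSup ⟨1, F.innerValues_le_one X⟩ (Set.mem_insert _ _),
      csSup_le (Set.insert_nonempty _ _) (F.innerValues_le_one X)⟩
  mon X Y h :=
    csSup_le_csSup ⟨1, F.innerValues_le_one Y⟩ (Set.insert_nonempty _ _)
      (Set.insert_subset_insert (Set.image_mono fun _ hφ => hφ.trans h))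
  negp φ := by rw [extN_eq_extP_neg]
  ex φ χ := by
    simp only [F.sSup_innerValues_extP, FourModel.bel]
    linarith [F.bcex φ χ]

/-! ### From ±-probabilities to 4-probabilities -/

/-- Extend a BD model by a point where every variable is both true and false and a point where
every variable is neither. -/
def BDModel.withGlutGap {W : Type} (M : BDModel W) : BDModel (W ⊕ Bool) where
  vpos p := Sum.elim (M.vpos p) (· = true)
  vneg p := Sum.elim (M.vneg p) (· = true)

theorem BDModel.supp_withGlutGap_inl {W : Type} (M : BDModel W) (φ : BD) (w : W) :
    (suppT M.withGlutGap φ (.inl w) ↔ suppT M φ w) ∧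
      (suppF M.withGlutGap φ (.inl w) ↔ suppF M φ w) := by
  induction φ with
  | var p => exact ⟨Iff.rfl, Iff.rfl⟩
  | neg φ ih => simpa [suppT, suppF] using ih.symm
  | and φ χ ihφ ihχ => simp only [suppT, suppF, ihφ, ihχ, and_self]
  | or φ χ ihφ ihχ => simp only [suppT, suppF, ihφ, ihχ, and_self]

theorem BDModel.supp_withGlutGap_inr {W : Type} (M : BDModel W) (φ : BD) (b : Bool) :
    (suppT M.withGlutGap φ (.inr b) ↔ b = true) ∧
      (suppF M.withGlutGap φ (.inr b) ↔ b = true) := by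
  induction φ with
  | var p => exact ⟨Iff.rfl, Iff.rfl⟩
  | neg φ ih => simpa [suppT, suppF] using ih.symm
  | and φ χ ihφ ihχ => simp only [suppT, suppF, ihφ, ihχ, and_self, or_self]
  | or φ χ ihφ ihχ => simp only [suppT, suppF, ihφ, ihχ, and_self, or_self]

theorem BDModel.inl_preimage_extP_withGlutGap {W : Type} (M : BDModel W) (φ : BD) :
    Sum.inl ⁻¹' extP M.withGlutGap φ = extP M φ :=
  Set.ext fun w => (M.supp_withGlutGap_inl φ w).1

theorem BDModel.inl_preimage_extN_withGlutGap {W : Type} (M : BDModel W) (φ : BD) :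
    Sum.inl ⁻¹' extN M.withGlutGap φ = extN M φ :=
  Set.ext fun w => (M.supp_withGlutGap_inl φ w).2

theorem BDModel.inr_mem_extP_withGlutGap {W : Type} (M : BDModel W) (φ : BD) (b : Bool) :
    .inr b ∈ extP M.withGlutGap φ ↔ b = true :=
  (M.supp_withGlutGap_inr φ b).1

theorem BDModel.inr_mem_extN_withGlutGap {W : Type} (M : BDModel W) (φ : BD) (b : Bool) :
    .inr b ∈ extN M.withGlutGap φ ↔ b = true :=
  (M.supp_withGlutGap_inr φ b).2

theorem extC_eq_extP {W : Type} (M : BDModel W) (φ : BD) :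
    extC M φ = extP M (φ.and φ.neg) := by
  rw [extP_and, ← extN_eq_extP_neg, extC]

theorem extU_eq_compl_extP {W : Type} (M : BDModel W) (φ : BD) :
    extU M φ = (extP M (φ.or φ.neg))ᶜ := by
  rw [extP_or, ← extN_eq_extP_neg, extU]

/-- The probability of pure belief only depends on the pure belief extension. -/
theorem PrModel.sub_eq_sub_of_extB_eq {W : Type} [Nonempty W] (P : PrModel W) {φ ψ : BD}
    (h : extB P.M φ = extB P.M ψ) :
    P.mu (extP P.M φ) - P.mu (extC P.M φ) = P.mu (extP P.M ψ) - P.mu (extC P.M ψ) := by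
  have hφ := P.ex φ ((φ.and φ.neg).or (ψ.and ψ.neg))
  have hψ := P.ex ψ ((φ.and φ.neg).or (ψ.and ψ.neg))
  have mem (w : W) : w ∈ extP P.M φ ∧ w ∉ extN P.M φ ↔ w ∈ extP P.M ψ ∧ w ∉ extN P.M ψ :=
    Set.ext_iff.1 h w
  have hor : extP P.M (φ.or ((φ.and φ.neg).or (ψ.and ψ.neg))) =
      extP P.M (ψ.or ((φ.and φ.neg).or (ψ.and ψ.neg))) := by
    ext w
    have := mem w
    simp only [extP_or, extP_and, ← extN_eq_extP_neg, Set.mem_union, Set.mem_inter_iff]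
    tauto
  have handφ : extP P.M (φ.and ((φ.and φ.neg).or (ψ.and ψ.neg))) = extC P.M φ := by
    ext w
    have := mem w
    simp only [extC, extP_or, extP_and, ← extN_eq_extP_neg, Set.mem_union, Set.mem_inter_iff]
    tauto
  have handψ : extP P.M (ψ.and ((φ.and φ.neg).or (ψ.and ψ.neg))) = extC P.M ψ := by
    ext w
    have := mem w
    simp only [extC, extP_or, extP_and, ← extN_eq_extP_neg, Set.mem_union, Set.mem_inter_iff]
    tauto
  rw [handφ] at hφ
  rw [handψ, ← hor] at hψ
  linarith

open Classical in
/-- The set function of the 4-probability induced by a ±-probability. The two extra points tell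
apart conflict, uncertainty and pure belief extensions. -/
noncomputable def PrModel.fourMu {W : Type} [Nonempty W] (P : PrModel W)
    (X : Set (W ⊕ Bool)) : ℝ :=
  if .inr true ∈ X then P.mu (Sum.inl ⁻¹' X)
  else if .inr false ∈ X then 1 - P.mu (Sum.inl ⁻¹' Xᶜ)
  else if h : ∃ φ, Sum.inl ⁻¹' X = extB P.M φ then
    P.mu (extP P.M h.choose) - P.mu (extC P.M h.choose)
  else 0

theorem PrModel.fourMu_mem {W : Type} [Nonempty W] (P : PrModel W) (X : Set (W ⊕ Bool)) :
    P.fourMu X ∈ Set.Icc (0 : ℝ) 1 := by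
  unfold PrModel.fourMu
  split_ifs with _ _ h
  · exact P.mu_mem _
  · have := P.mu_mem (Sum.inl ⁻¹' Xᶜ)
    exact ⟨by linarith [this.2], by linarith [this.1]⟩
  · have hle := P.mon (extC P.M h.choose) (extP P.M h.choose) Set.inter_subset_left
    exact ⟨by linarith, by linarith [(P.mu_mem (extP P.M h.choose)).2,
      (P.mu_mem (extC P.M h.choose)).1]⟩
  · simp

theorem PrModel.fourMu_extC {W : Type} [Nonempty W] (P : PrModel W) (φ : BD) :
    P.fourMu (extC P.M.withGlutGap φ) = P.mu (extC P.M φ) := by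
  rw [PrModel.fourMu, if_pos (by
    simp [extC, BDModel.inr_mem_extP_withGlutGap, BDModel.inr_mem_extN_withGlutGap])]
  simp only [extC, Set.preimage_inter, BDModel.inl_preimage_extP_withGlutGap,
    BDModel.inl_preimage_extN_withGlutGap]

theorem PrModel.fourMu_extU {W : Type} [Nonempty W] (P : PrModel W) (φ : BD) :
    P.fourMu (extU P.M.withGlutGap φ) = 1 - P.mu (extP P.M (φ.or φ.neg)) := by
  rw [PrModel.fourMu, extU_eq_compl_extP,
    if_neg (by simp [BDModel.inr_mem_extP_withGlutGap]),
    if_pos (by simp [BDModel.inr_mem_extP_withGlutGap]),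
    compl_compl, BDModel.inl_preimage_extP_withGlutGap]

theorem PrModel.fourMu_extB {W : Type} [Nonempty W] (P : PrModel W) (φ : BD) :
    P.fourMu (extB P.M.withGlutGap φ) = P.mu (extP P.M φ) - P.mu (extC P.M φ) := by
  have h : Sum.inl ⁻¹' extB P.M.withGlutGap φ = extB P.M φ := by
    simp only [extB, Set.preimage_sdiff, BDModel.inl_preimage_extP_withGlutGap,
      BDModel.inl_preimage_extN_withGlutGap]
  have hex : ∃ ψ, Sum.inl ⁻¹' extB P.M.withGlutGap φ = extB P.M ψ := ⟨φ, h⟩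
  rw [PrModel.fourMu,
    if_neg (by simp [extB, BDModel.inr_mem_extP_withGlutGap, BDModel.inr_mem_extN_withGlutGap]),
    if_neg (by simp [extB, BDModel.inr_mem_extP_withGlutGap]), dif_pos hex]
  exact P.sub_eq_sub_of_extB_eq (hex.choose_spec.symm.trans h)

theorem extB_neg {W : Type} (M : BDModel W) (φ : BD) : extB M φ.neg = extD M φ := by
  rw [extB, extD, ← extN_eq_extP_neg, extN_neg]

theorem extC_neg {W : Type} (M : BDModel W) (φ : BD) : extC M φ.neg = extC M φ := by
  rw [extC, extC, ← extN_eq_extP_neg, extN_neg, Set.inter_comm]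

theorem extC_and_neg_self {W : Type} (M : BDModel W) (φ : BD) :
    extC M (φ.and φ.neg) = extC M φ := by
  ext w
  simp only [extC, extP_and, extN_and, extN_neg, ← extN_eq_extP_neg, Set.mem_inter_iff,
    Set.mem_union]
  tauto

/-- The 4-probability model induced by a ±-probability model. -/
noncomputable def PrModel.toFourModel {W : Type} [Nonempty W] (P : PrModel W) :
    FourModel (W ⊕ Bool) where
  M := P.M.withGlutGap
  mu := P.fourMu
  mu_mem := P.fourMu_mem
  part φ := by
    have := P.ex φ φ.neg
    rw [← extB_neg, P.fourMu_extB, P.fourMu_extB, P.fourMu_extU, P.fourMu_extC, extC_neg, this,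
      ← extC_eq_extP]
    ring
  negb φ := by rw [extB_neg]
  negc φ := by rw [extC_neg]
  contrb φ := by rw [P.fourMu_extB, extC_and_neg_self, extC_eq_extP, sub_self]
  contrc φ := by rw [extC_and_neg_self]
  bcmon φ ψ h _ := by
    have := P.mon (extP P.M φ) (extP P.M ψ) (by
      simpa only [BDModel.inl_preimage_extP_withGlutGap] using
        Set.preimage_mono (f := Sum.inl) h)
    simpa only [P.fourMu_extB, P.fourMu_extC, sub_add_cancel] using this
  bcex φ ψ := by
    simp only [P.fourMu_extB, P.fourMu_extC]
    linarith [P.ex φ ψ]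

theorem pe1_toPr_eq_one_of_FourValid {β : FourF} (h : FourValid β) {W : Type} [Nonempty W]
    (P : PrModel W) : pe1 P β.toPr = 1 := by
  rw [fe_eq_pe1_toPr P.toFourModel P fun φ => ?_]
  · exact h _ _ _
  · simp only [PrModel.toFourModel, P.fourMu_extB, P.fourMu_extC, sub_add_cancel]

/-- Theorem 2: β is 4PrŁΔ valid iff β^± is Pr_Ł²Δ valid. -/
theorem FourValid_iff_toPr_PrValid (β : FourF) :
    FourValid β ↔ PrValid β.toPr := by
  constructor
  · intro h W _ P
    have hdual := pe1_toPr_eq_one_of_FourValid h P.dual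
    rw [(P.pe_dual _).1] at hdual
    exact ⟨pe1_toPr_eq_one_of_FourValid h P, by linarith⟩
  · intro h W _ F
    rw [← fe_eq_pe1_toPr F F.toPrModel F.sSup_innerValues_extP]
    exact (h _ _ _).1
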